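/- arXiv:1411.5631 — 10 statements merged into one kernel-verified Lean document; each statement's English description precedes it below -/
import Mathlib

section
/- For every natural number φ, the number of triples (i, j, k) of natural numbers satisfying k ∈ {0, 1} and 2i + 3j + 3k ≤ φ equals 1 + ⌊φ(φ+3)/6⌋. (This is the cardinality n_r(φ) of the monomial rotationally symmetric basis 𝒬^φ_r = {L̃₂^i L̃₃^j L̃_A^k : 2i + 3j + 3k ≤ φ, k ∈ {0,1}}.) -/
/-- Passing from degree `φ` to `φ + 3` multiplies the old monomials by `L̃₃`; the new ones
are those with exponent `j = 0`. -/
theorem exists_finset_rotational_exponents : ∀ φ : ℕ, ∃ s : Finset (ℕ × ℕ × ℕ),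
    (∀ i j k, (i, j, k) ∈ s ↔ k ≤ 1 ∧ 2 * i + 3 * j + 3 * k ≤ φ) ∧
      s.card = 1 + φ * (φ + 3) / 6
  | 0 => ⟨{(0, 0, 0)}, fun i j k => by simp; omega, rfl⟩
  | 1 => ⟨{(0, 0, 0)}, fun i j k => by simp; omega, rfl⟩
  | 2 => ⟨{(0, 0, 0), (1, 0, 0)}, fun i j k => by simp; omega, rfl⟩
  | φ + 3 => by
    obtain ⟨s, hs, hcard⟩ := exists_finset_rotational_exponents φ
    let shift : ℕ × ℕ × ℕ ↪ ℕ × ℕ × ℕ :=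
      ⟨fun t => (t.1, t.2.1 + 1, t.2.2), fun a b h => by
        simp only [Prod.mk.injEq, Nat.add_right_cancel_iff] at h
        exact Prod.ext h.1 (Prod.ext h.2.1 h.2.2)⟩
    let base (k : ℕ) : ℕ ↪ ℕ × ℕ × ℕ := ⟨fun i => (i, 0, k), fun a b h => congrArg Prod.fst h⟩
    have hshift (i j k : ℕ) : shift (i, j, k) = (i, j + 1, k) := rfl
    have hbase (k i : ℕ) : base k i = (i, 0, k) := rfl
    have hd₁ : Disjoint ((Finset.range ((φ + 3) / 2 + 1)).map (base 0))
        ((Finset.range (φ / 2 + 1)).map (base 1)) := by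
      simp [Finset.disjoint_left, hbase]
    have hd₂ : Disjoint (s.map shift) (((Finset.range ((φ + 3) / 2 + 1)).map (base 0)).disjUnion
        ((Finset.range (φ / 2 + 1)).map (base 1)) hd₁) := by
      simp only [Finset.disjoint_left, Finset.mem_disjUnion, Finset.mem_map]
      rintro _ ⟨⟨i, j, k⟩, -, rfl⟩ (⟨a, -, h⟩ | ⟨a, -, h⟩) <;>
        simp [hshift, hbase] at h
    refine ⟨(s.map shift).disjUnion _ hd₂, fun i j k => ?_, ?_⟩
    · simp only [Finset.mem_disjUnion, Finset.mem_map, Finset.mem_range, Prod.exists, hs,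
        hshift, hbase, Prod.mk.injEq]
      constructor
      · rintro (⟨a, b, c, h, rfl, rfl, rfl⟩ | ⟨a, h, rfl, rfl, rfl⟩ | ⟨a, h, rfl, rfl, rfl⟩) <;>
          omega
      · rintro ⟨hk, h⟩
        rcases j with _ | j
        · obtain rfl | rfl : k = 0 ∨ k = 1 := by omega
          · exact .inr (.inl ⟨i, by omega, rfl, rfl, rfl⟩)
          · exact .inr (.inr ⟨i, by omega, rfl, rfl, rfl⟩)
        · exact .inl ⟨i, j, k, ⟨hk, by omega⟩, rfl, rfl, rfl⟩
    · simp only [Finset.card_disjUnion, Finset.card_map, Finset.card_range, hcard]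
      have h : (φ + 3) * (φ + 3 + 3) = φ * (φ + 3) + 6 * (φ + 3) := by ring
      rw [h]
      omega

/-- Cardinality `n_r(φ)` of the monomial rotationally symmetric basis:
the number of triples `(i, j, k)` of naturals with `k ∈ {0, 1}` and
`2i + 3j + 3k ≤ φ` equals `1 + ⌊φ(φ+3)/6⌋`. -/
theorem stmt_6 (φ : ℕ) :
    {t : ℕ × ℕ × ℕ | t.2.2 ≤ 1 ∧ 2 * t.1 + 3 * t.2.1 + 3 * t.2.2 ≤ φ}.ncard =
      1 + φ * (φ + 3) / 6 := by
  obtain ⟨s, hs, hcard⟩ := exists_finset_rotational_exponents φ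
  rw [← hcard, ← Set.ncard_coe_finset]
  congr 1
  ext ⟨i, j, k⟩
  exact (hs i j k).symm
end

section
/- For every natural number ω, the number of triples (i, j, k) of natural numbers satisfying k ∈ {0, 1} and 2i + 3j + 3k = ω equals 1 + ⌊ω/3⌋ − κ₃(ω), where κ₃(ω) = 1 if ω mod 3 = 1 and κ₃(ω) = 0 otherwise. (This is the number m_r(ω) of rotationally symmetric basis monomials of degree ω.) -/
/-- Number `m_r(ω)` of rotationally symmetric basis monomials of degree `ω`:
the number of triples `(i, j, k)` of naturals with `k ∈ {0, 1}` and
`2i + 3j + 3k = ω` equals `1 + ⌊ω/3⌋ − κ₃(ω)`, where `κ₃(ω) = 1` if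
`ω mod 3 = 1` and `0` otherwise. -/
theorem stmt_7 (ω : ℕ) :
    {t : ℕ × ℕ × ℕ | t.2.2 ≤ 1 ∧ 2 * t.1 + 3 * t.2.1 + 3 * t.2.2 = ω}.ncard =
      1 + ω / 3 - (if ω % 3 = 1 then 1 else 0) := by
  -- The triple `(i, j, k)` is numbered by `j + 2 * k - 1` (truncated subtraction).
  refine Set.ncard_eq_of_bijective
    (fun m _ => if m = 0 ∧ ω % 2 = 0 then (ω / 2, 0, 0)
      else if (m + 1) % 2 = ω % 2 then ((ω - 3 * (m + 1)) / 2, m + 1, 0)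
      else ((ω - 3 * m) / 2, m - 1, 1)) ?_ ?_ ?_
  · rintro ⟨i, j, k⟩ ⟨hk, h⟩
    dsimp only at hk h
    refine ⟨j + 2 * k - 1, ?_, ?_⟩
    · split_ifs <;> omega
    · interval_cases k <;> rcases Nat.mod_two_eq_zero_or_one j with hj | hj <;>
        split_ifs <;> refine Prod.ext ?_ (Prod.ext ?_ ?_) <;> dsimp only <;> omega
  · intro m hm
    simp only [Set.mem_ofPred_eq]
    rcases Nat.mod_two_eq_zero_or_one ω with hω | hω <;>
      rcases Nat.mod_two_eq_zero_or_one m with hm2 | hm2 <;>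
      split_ifs at hm ⊢ <;> dsimp only <;> omega
  · intro m n hm hn h
    split_ifs at h <;> simp only [Prod.mk.injEq] at h <;> omega
end

section
/- For every natural number φ, the number of pairs (i, j) of natural numbers satisfying i even, 0 ≤ i ≤ ⌊φ/3⌋, 2i ≤ j ≤ φ − i and j ≠ 2i + 1 equals ⌊((φ+3)² + 3)/12⌋. (The minimal objective basis 𝒫̃^φ_m of equation (16) has cardinality n_m(φ).) -/
/-- The index set of the minimal objective basis of degree `φ`. -/
def minimalIndexSet (φ : ℕ) : Set (ℕ × ℕ) :=
  {p : ℕ × ℕ | Even p.1 ∧ p.1 ≤ φ / 3 ∧ 2 * p.1 ≤ p.2 ∧ p.2 ≤ φ - p.1 ∧ p.2 ≠ 2 * p.1 + 1}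

/-- The part of the index set with first component zero. -/
def minimalIndexRow (φ : ℕ) : Finset (ℕ × ℕ) :=
  {0} ×ˢ (Finset.range (φ + 1)).erase 1

theorem minimalIndexSet_eq_row {φ : ℕ} (h : φ < 6) :
    minimalIndexSet φ = minimalIndexRow φ := by
  ext ⟨i, j⟩
  simp only [minimalIndexSet, minimalIndexRow, Set.mem_ofPred_eq, Finset.mem_coe,
    Finset.mem_product, Finset.mem_singleton, Finset.mem_erase, Finset.mem_range, Nat.even_iff]
  lia

theorem minimalIndexSet_add_six (φ : ℕ) :
    minimalIndexSet (φ + 6) =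
      (minimalIndexRow (φ + 6) : Set (ℕ × ℕ)) ∪ (fun p => p + (2, 4)) '' minimalIndexSet φ := by
  ext ⟨i, j⟩
  simp only [minimalIndexSet, minimalIndexRow, Set.mem_union, Set.mem_image, Set.mem_ofPred_eq,
    Finset.mem_coe, Finset.mem_product, Finset.mem_singleton, Finset.mem_erase,
    Finset.mem_range, Nat.even_iff, Prod.exists, Prod.mk_add_mk, Prod.mk.injEq]
  constructor
  · intro h
    by_cases hi : i = 0
    · left; lia
    · exact Or.inr ⟨i - 2, j - 4, by lia⟩
  · rintro (h | ⟨a, b, h⟩) <;> lia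

theorem minimalIndexSet_finite (φ : ℕ) : (minimalIndexSet φ).Finite := by
  refine (Set.finite_Iic (φ, φ)).subset ?_
  rintro ⟨i, j⟩ ⟨-, hi, -, hj, -⟩
  exact Prod.mk_le_mk.2 ⟨by lia, by lia⟩

theorem ncard_minimalIndexSet_add_six (φ : ℕ) :
    (minimalIndexSet (φ + 6)).ncard = (minimalIndexSet φ).ncard + (φ + 6) := by
  have hdisj : Disjoint (minimalIndexRow (φ + 6) : Set (ℕ × ℕ))
      ((fun p => p + (2, 4)) '' minimalIndexSet φ) := by
    rw [Set.disjoint_left]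
    rintro _ hrow ⟨⟨i, j⟩, -, rfl⟩
    simp [minimalIndexRow] at hrow
  rw [minimalIndexSet_add_six,
    Set.ncard_union_eq hdisj (Finset.finite_toSet _) ((minimalIndexSet_finite φ).image _),
    Set.ncard_image_of_injective _ (add_left_injective _), Set.ncard_coe_finset, add_comm]
  simp [minimalIndexRow]

theorem ncard_minimalIndexSet (φ : ℕ) :
    (minimalIndexSet φ).ncard = ((φ + 3) ^ 2 + 3) / 12 := by
  induction φ using Nat.strong_induction_on with
  | _ φ ih =>
    by_cases h : φ < 6
    · rw [minimalIndexSet_eq_row h, Set.ncard_coe_finset]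
      interval_cases φ <;> rfl
    · obtain ⟨k, rfl⟩ := Nat.exists_eq_add_of_le' (not_lt.1 h)
      rw [ncard_minimalIndexSet_add_six, ih k (by lia),
        show (k + 6 + 3) ^ 2 + 3 = (k + 3) ^ 2 + 3 + 12 * (k + 6) by ring,
        Nat.add_mul_div_left _ _ (by norm_num)]

/-- The minimal objective basis `𝒫̃^φ_m` (equation (16)) has cardinality `n_m(φ)`:
the number of pairs `(i, j)` of naturals with `i` even, `i ≤ ⌊φ/3⌋`,
`2i ≤ j ≤ φ − i` and `j ≠ 2i + 1` equals `⌊((φ+3)² + 3)/12⌋`. -/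
theorem stmt_8 (φ : ℕ) :
    {p : ℕ × ℕ | Even p.1 ∧ p.1 ≤ φ / 3 ∧ 2 * p.1 ≤ p.2 ∧ p.2 ≤ φ - p.1 ∧
      p.2 ≠ 2 * p.1 + 1}.ncard = ((φ + 3) ^ 2 + 3) / 12 := by
  exact ncard_minimalIndexSet φ
end

section
/- For every natural number φ, the number of pairs (i, j) of natural numbers satisfying i even, 0 ≤ i ≤ φ and 0 ≤ j ≤ min(φ − i, i/2) equals ⌊((φ+3)² + 3)/12⌋. (The minimal objective basis 𝒫̃^φ_{m₂} of equation (17) has cardinality n_m(φ).) -/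
/-- The index set of the basis in degree `φ + 3` splits into the pairs with `j = 0` and a shifted
copy of the index set in degree `φ`. -/
theorem indexSet_add_three (φ : ℕ) :
    {p : ℕ × ℕ | Even p.1 ∧ p.1 ≤ φ + 3 ∧ p.2 ≤ min (φ + 3 - p.1) (p.1 / 2)} =
      (fun p : ℕ × ℕ => (p.1 + 2, p.2 + 1)) ''
          {p : ℕ × ℕ | Even p.1 ∧ p.1 ≤ φ ∧ p.2 ≤ min (φ - p.1) (p.1 / 2)} ∪
        (fun k : ℕ => (2 * k, 0)) '' (Finset.range ((φ + 3) / 2 + 1) : Set ℕ) := by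
  ext ⟨i, j⟩
  simp only [Set.mem_ofPred_eq, Set.mem_union, Set.mem_image, Prod.exists, Prod.mk.injEq,
    Finset.coe_range, Set.mem_Iio, Nat.even_iff, le_min_iff]
  constructor
  · rintro ⟨h, hi, hj⟩
    rcases j with _ | j
    · exact Or.inr ⟨i / 2, by omega, by omega, rfl⟩
    · exact Or.inl ⟨i - 2, j, by omega, by omega, rfl⟩
  · rintro (⟨a, b, h, rfl, rfl⟩ | ⟨k, h, rfl, rfl⟩) <;> omega

theorem finite_indexSet (φ : ℕ) :
    {p : ℕ × ℕ | Even p.1 ∧ p.1 ≤ φ ∧ p.2 ≤ min (φ - p.1) (p.1 / 2)}.Finite := by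
  refine (Set.finite_Iic (φ, φ)).subset ?_
  rintro ⟨i, j⟩ ⟨-, hi, hj⟩
  simp only [le_min_iff] at hi hj
  exact ⟨hi, by dsimp only; omega⟩

theorem ncard_indexSet_add_three (φ : ℕ) :
    {p : ℕ × ℕ | Even p.1 ∧ p.1 ≤ φ + 3 ∧ p.2 ≤ min (φ + 3 - p.1) (p.1 / 2)}.ncard =
      {p : ℕ × ℕ | Even p.1 ∧ p.1 ≤ φ ∧ p.2 ≤ min (φ - p.1) (p.1 / 2)}.ncard +
        ((φ + 3) / 2 + 1) := by
  rw [indexSet_add_three, Set.ncard_union_eq ?_ ((finite_indexSet φ).image _)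
    ((Finset.finite_toSet _).image _), Set.ncard_image_of_injective, Set.ncard_image_of_injective,
    Set.ncard_coe_finset, Finset.card_range]
  · intro a b h
    simpa using h
  · rintro ⟨a, b⟩ ⟨c, d⟩ h
    simpa using h
  · rw [Set.disjoint_left]
    rintro _ ⟨p, -, rfl⟩ ⟨k, -, h⟩
    simp at h

theorem ncard_indexSet_of_lt_three {φ : ℕ} (hφ : φ < 3) :
    {p : ℕ × ℕ | Even p.1 ∧ p.1 ≤ φ ∧ p.2 ≤ min (φ - p.1) (p.1 / 2)}.ncard = φ / 2 + 1 := by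
  have h : {p : ℕ × ℕ | Even p.1 ∧ p.1 ≤ φ ∧ p.2 ≤ min (φ - p.1) (p.1 / 2)} =
      (fun k : ℕ => (2 * k, 0)) '' (Finset.range (φ / 2 + 1) : Set ℕ) := by
    ext ⟨i, j⟩
    simp only [Set.mem_ofPred_eq, Set.mem_image, Prod.mk.injEq,
      Finset.coe_range, Set.mem_Iio, Nat.even_iff, le_min_iff]
    constructor
    · rintro ⟨h, hi, hj⟩
      exact ⟨i / 2, by omega, by omega, by omega⟩
    · rintro ⟨k, h, rfl, rfl⟩
      omega
  rw [h, Set.ncard_image_of_injective _ (fun a b h => by simpa using h),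
    Set.ncard_coe_finset, Finset.card_range]

theorem sq_add_three_div_twelve_step (φ : ℕ) :
    ((φ + 3 + 3) ^ 2 + 3) / 12 = ((φ + 3) ^ 2 + 3) / 12 + ((φ + 3) / 2 + 1) := by
  obtain ⟨q, r, hr, rfl⟩ : ∃ q r, r < 6 ∧ φ = 6 * q + r :=
    ⟨φ / 6, φ % 6, Nat.mod_lt _ (by norm_num), (Nat.div_add_mod φ 6).symm⟩
  interval_cases r <;> ring_nf <;> omega

/-- The minimal objective basis `𝒫̃^φ_{m₂}` (equation (17)) has cardinality `n_m(φ)`: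
the number of pairs `(i, j)` of naturals with `i` even, `i ≤ φ` and
`j ≤ min(φ − i, i/2)` equals `⌊((φ+3)² + 3)/12⌋`. -/
theorem stmt_9 (φ : ℕ) :
    {p : ℕ × ℕ | Even p.1 ∧ p.1 ≤ φ ∧ p.2 ≤ min (φ - p.1) (p.1 / 2)}.ncard =
      ((φ + 3) ^ 2 + 3) / 12 := by
  induction φ using Nat.strong_induction_on with
  | _ φ ih =>
    rcases lt_or_ge φ 3 with hφ | hφ
    · rw [ncard_indexSet_of_lt_three hφ]
      interval_cases φ <;> rfl
    · obtain ⟨n, rfl⟩ := Nat.exists_eq_add_of_le' hφ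
      rw [ncard_indexSet_add_three, ih n (by omega), sq_add_three_div_twelve_step]
end

section
/- For every natural number φ, the number of pairs (i, j) of natural numbers satisfying i even, 0 ≤ i ≤ 2⌊φ/3⌋ + 2κ₆(φ−1), and 2⌊i/4⌋ ≤ j ≤ min(φ − i, 2i), equals ⌊((φ+3)² + 3)/12⌋, where κ₆(n) = 1 if n mod 6 = 1 and κ₆(n) = 0 otherwise. (The minimal objective basis 𝒫̃^φ_{m₃} of equation (18) has cardinality n_m(φ).) -/
/-- The number of admissible `j` paired with `i = 2 * k` in degree `φ`. -/
def rowCard (φ k : ℕ) : ℕ := min (φ - 2 * k) (4 * k) + 1 - 2 * (k / 2)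

/-- Half of the largest admissible `i` in degree `φ`. -/
def halfBound (φ : ℕ) : ℕ := φ / 3 + if (φ - 1) % 6 = 1 then 1 else 0

theorem halfBound_add_twelve (φ : ℕ) : halfBound (φ + 12) = halfBound φ + 4 := by
  unfold halfBound
  split_ifs <;> omega

theorem rowCard_add_twelve {φ k : ℕ} (hk : k ≤ halfBound φ) :
    rowCard (φ + 12) (k + 2) = rowCard φ k + 6 := by
  unfold halfBound at hk
  unfold rowCard
  split_ifs at hk <;> omega

theorem sum_rowCard_add_twelve (φ : ℕ) :
    ∑ k ∈ Finset.range (halfBound (φ + 12) + 1), rowCard (φ + 12) k =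
      ∑ k ∈ Finset.range (halfBound φ + 1), rowCard φ k + 2 * φ + 18 := by
  have hshift : ∑ k ∈ Finset.range (halfBound φ + 1), rowCard (φ + 12) (k + 2) =
      ∑ k ∈ Finset.range (halfBound φ + 1), rowCard φ k + (halfBound φ + 1) * 6 := by
    rw [Finset.sum_congr rfl fun k hk =>
      rowCard_add_twelve (Nat.lt_succ_iff.mp (Finset.mem_range.mp hk))]
    simp [Finset.sum_add_distrib]
  have hends : (halfBound φ + 1) * 6 + rowCard (φ + 12) (halfBound φ + 3) +
      rowCard (φ + 12) (halfBound φ + 4) + rowCard (φ + 12) 1 + rowCard (φ + 12) 0 =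
      2 * φ + 18 := by
    unfold rowCard halfBound
    split_ifs <;> omega
  rw [halfBound_add_twelve, Finset.sum_range_succ', Finset.sum_range_succ',
    Finset.sum_range_succ, Finset.sum_range_succ]
  simp only [add_assoc, Nat.reduceAdd, zero_add] at hshift hends ⊢
  omega

theorem sum_rowCard (φ : ℕ) :
    ∑ k ∈ Finset.range (halfBound φ + 1), rowCard φ k = ((φ + 3) ^ 2 + 3) / 12 := by
  induction φ using Nat.strong_induction_on with
  | _ φ ih =>
    by_cases h : φ < 12
    · clear ih
      revert φ
      decide
    · obtain ⟨ψ, rfl⟩ := Nat.exists_eq_add_of_le' (not_lt.mp h)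
      rw [sum_rowCard_add_twelve, ih ψ (by omega),
        show (ψ + 12 + 3) ^ 2 = (ψ + 3) ^ 2 + 12 * (2 * ψ + 18) by ring]
      omega

/-- The minimal objective basis `𝒫̃^φ_{m₃}` (equation (18)) has cardinality `n_m(φ)`:
the number of pairs `(i, j)` of naturals with `i` even,
`i ≤ 2⌊φ/3⌋ + 2κ₆(φ−1)` and `2⌊i/4⌋ ≤ j ≤ min(φ − i, 2i)` equals
`⌊((φ+3)² + 3)/12⌋`, where `κ₆(n) = 1` if `n mod 6 = 1` and `0` otherwise. -/
theorem stmt_10 (φ : ℕ) :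
    {p : ℕ × ℕ | Even p.1 ∧
      p.1 ≤ 2 * (φ / 3) + 2 * (if (φ - 1) % 6 = 1 then 1 else 0) ∧
      2 * (p.1 / 4) ≤ p.2 ∧ p.2 ≤ min (φ - p.1) (2 * p.1)}.ncard =
      ((φ + 3) ^ 2 + 3) / 12 := by
  have hset : {p : ℕ × ℕ | Even p.1 ∧
      p.1 ≤ 2 * (φ / 3) + 2 * (if (φ - 1) % 6 = 1 then 1 else 0) ∧
      2 * (p.1 / 4) ≤ p.2 ∧ p.2 ≤ min (φ - p.1) (2 * p.1)} =
      (((Finset.range (halfBound φ + 1)).sigma fun k =>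
        Finset.Icc (2 * (k / 2)) (min (φ - 2 * k) (4 * k))).image
        fun x => (2 * x.1, x.2) : Finset (ℕ × ℕ)) := by
    ext ⟨i, j⟩
    simp only [Set.mem_ofPred_eq, Finset.coe_image, Set.mem_image, Finset.mem_coe,
      Finset.mem_sigma, Finset.mem_range, Finset.mem_Icc, Prod.mk.injEq, halfBound]
    constructor
    · rintro ⟨⟨k, rfl⟩, hi, hj, hj'⟩
      refine ⟨⟨k, j⟩, ⟨?_, ?_, ?_⟩, ?_, rfl⟩ <;> dsimp only <;> omega
    · rintro ⟨⟨k, j⟩, ⟨hk, hj, hj'⟩, rfl, rfl⟩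
      dsimp only at hk hj hj' ⊢
      exact ⟨even_two_mul k, by omega, by omega, by omega⟩
  have hinj : Function.Injective fun x : (_ : ℕ) × ℕ => (2 * x.1, x.2) := by
    rintro ⟨a, b⟩ ⟨c, d⟩ h
    simpa using h
  rw [hset, Set.ncard_coe_finset, Finset.card_image_of_injective _ hinj, Finset.card_sigma,
    ← sum_rowCard]
  simp only [Nat.card_Icc, rowCard]
end

section
/- For every natural number φ, the set of index pairs {(2i, ω − 2i) : 0 ≤ ω ≤ φ, 0 ≤ i ≤ m_m(ω) − 1}, where m_m(ω) = 1 + ⌊ω/6⌋ − κ₆(ω), is equal to the set {(i, j) ∈ ℕ² : i even, 0 ≤ i ≤ ⌊φ/3⌋, 2i ≤ j ≤ φ − i, j ≠ 2i + 1}. (Equations (13) and (16) describe the same minimal objective basis 𝒫̃^φ_m.) -/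
/-- Equations (13) and (16) describe the same minimal objective basis `𝒫̃^φ_m`:
the set `{(2i, ω − 2i) : 0 ≤ ω ≤ φ, 0 ≤ i ≤ m_m(ω) − 1}` (the bound on `i`
expressed as `i < m_m(ω)`, so that `m_m(ω) = 0` contributes nothing), with
`m_m(ω) = 1 + ⌊ω/6⌋ − κ₆(ω)`, equals
`{(i, j) : i even, i ≤ ⌊φ/3⌋, 2i ≤ j ≤ φ − i, j ≠ 2i + 1}`. -/
theorem stmt_11 (φ : ℕ) :
    {x : ℕ × ℕ | ∃ ω i : ℕ, ω ≤ φ ∧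
        i < 1 + ω / 6 - (if ω % 6 = 1 then 1 else 0) ∧ x = (2 * i, ω - 2 * i)} =
    {x : ℕ × ℕ | Even x.1 ∧ x.1 ≤ φ / 3 ∧ 2 * x.1 ≤ x.2 ∧ x.2 ≤ φ - x.1 ∧
        x.2 ≠ 2 * x.1 + 1} := by
  ext ⟨a, b⟩
  simp only [Set.mem_ofPred_eq, Prod.mk.injEq]
  constructor
  · rintro ⟨ω, i, hω, hi, rfl, rfl⟩
    refine ⟨even_two_mul i, ?_⟩
    split_ifs at hi <;> omega
  · rintro ⟨⟨k, rfl⟩, h1, h2, h3, h4⟩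
    refine ⟨b + 2 * k, k, by omega, ?_, by omega, by omega⟩
    split_ifs <;> omega
end

section
/- For every natural number φ, the set of index pairs {(2i, ω − 2i) : 0 ≤ ω ≤ φ, ⌊ω/2⌋ − (m_m(ω) − 1) ≤ i ≤ ⌊ω/2⌋}, where m_m(ω) = 1 + ⌊ω/6⌋ − κ₆(ω), is equal to the set {(i, j) ∈ ℕ² : i even, 0 ≤ i ≤ φ, 0 ≤ j ≤ min(φ − i, i/2)}. (Equations (14) and (17) describe the same minimal objective basis 𝒫̃^φ_{m₂}.) -/
/-- Equations (14) and (17) describe the same minimal objective basis `𝒫̃^φ_{m₂}`: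
the set `{(2i, ω − 2i) : 0 ≤ ω ≤ φ, ⌊ω/2⌋ − (m_m(ω) − 1) ≤ i ≤ ⌊ω/2⌋}` (the lower
bound on `i` written additively as `⌊ω/2⌋ + 1 ≤ i + m_m(ω)`, its meaning in `ℤ`),
with `m_m(ω) = 1 + ⌊ω/6⌋ − κ₆(ω)`, equals
`{(i, j) : i even, i ≤ φ, j ≤ min(φ − i, i/2)}`. -/
theorem stmt_12 (φ : ℕ) :
    {x : ℕ × ℕ | ∃ ω i : ℕ, ω ≤ φ ∧
        ω / 2 + 1 ≤ i + (1 + ω / 6 - (if ω % 6 = 1 then 1 else 0)) ∧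
        i ≤ ω / 2 ∧ x = (2 * i, ω - 2 * i)} =
    {x : ℕ × ℕ | Even x.1 ∧ x.1 ≤ φ ∧ x.2 ≤ min (φ - x.1) (x.1 / 2)} := by
  ext ⟨a, b⟩
  simp only [Set.mem_ofPred_eq, Prod.mk.injEq, le_min_iff]
  constructor
  · rintro ⟨ω, i, hω, hlow, hup, rfl, rfl⟩
    refine ⟨even_two_mul i, ?_⟩
    split_ifs at hlow <;> omega
  · rintro ⟨⟨k, rfl⟩, hk, hb, hbk⟩
    refine ⟨k + k + b, k, by omega, ?_, by omega, by omega, by omega⟩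
    split_ifs <;> omega
end

section
/- For every natural number φ, the number of pairs (i, j) of natural numbers satisfying 0 ≤ i ≤ ⌊φ/3⌋, 2i ≤ j ≤ φ − i and j ≠ 2i + 1 equals 1 + ⌊φ(φ+3)/6⌋. (The minimal objective basis 𝒫̃^φ_r of equation (26) for rotationally symmetric rules has cardinality n_r(φ).) -/
theorem card_Icc_erase_add_one (a b : ℕ) (h : a ≤ b) :
    ((Finset.Icc a b).erase (a + 1)).card = max (b - a) 1 := by
  rcases h.eq_or_lt with rfl | h
  · simp
  · rw [Finset.card_erase_of_mem (by simp; omega), Nat.card_Icc]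
    omega

theorem sum_range_max_sub_three_mul : ∀ n : ℕ,
    ∑ i ∈ Finset.range (n / 3 + 1), max (n - 3 * i) 1 = 1 + n * (n + 3) / 6
  | 0 => by decide
  | 1 => by decide
  | 2 => by decide
  | n + 3 => by
    have hdiv : (n + 3) / 3 + 1 = (n / 3 + 1) + 1 := by omega
    have hsub (i : ℕ) : n + 3 - 3 * (i + 1) = n - 3 * i := by omega
    have hmul : (n + 3) * (n + 3 + 3) = n * (n + 3) + 6 * (n + 3) := by ring
    rw [hdiv, Finset.sum_range_succ']
    simp only [hsub]
    rw [sum_range_max_sub_three_mul n, hmul]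
    omega

/-- The minimal objective basis `𝒫̃^φ_r` (equation (26)) for rotationally
symmetric rules has cardinality `n_r(φ)`: the number of pairs `(i, j)` of
naturals with `i ≤ ⌊φ/3⌋`, `2i ≤ j ≤ φ − i` and `j ≠ 2i + 1` equals
`1 + ⌊φ(φ+3)/6⌋`. -/
theorem stmt_13 (φ : ℕ) :
    {p : ℕ × ℕ | p.1 ≤ φ / 3 ∧ 2 * p.1 ≤ p.2 ∧ p.2 ≤ φ - p.1 ∧
      p.2 ≠ 2 * p.1 + 1}.ncard = 1 + φ * (φ + 3) / 6 := by
  let s := (Finset.range (φ / 3 + 1)).sigma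
    fun i ↦ (Finset.Icc (2 * i) (φ - i)).erase (2 * i + 1)
  have hs : {p : ℕ × ℕ | p.1 ≤ φ / 3 ∧ 2 * p.1 ≤ p.2 ∧ p.2 ≤ φ - p.1 ∧
      p.2 ≠ 2 * p.1 + 1} = (s.map (Equiv.sigmaEquivProd ℕ ℕ).toEmbedding : Finset (ℕ × ℕ)) := by
    ext ⟨i, j⟩
    simp only [Set.mem_ofPred_eq, Finset.mem_coe, Finset.mem_map_equiv, s, Finset.mem_sigma,
      Equiv.sigmaEquivProd_symm_apply, Finset.mem_range, Finset.mem_erase, Finset.mem_Icc]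
    omega
  rw [hs, Set.ncard_coe_finset, Finset.card_map, Finset.card_sigma,
    ← sum_range_max_sub_three_mul]
  refine Finset.sum_congr rfl fun i hi ↦ ?_
  rw [Finset.mem_range] at hi
  rw [card_Icc_erase_add_one _ _ (by omega)]
  congr 1
  omega
end

section
/- For every natural number φ, the number of pairs (i, j) of natural numbers satisfying 0 ≤ i ≤ φ and 0 ≤ j ≤ min(φ − i, ⌊i/2⌋ − κ₂(i)) equals 1 + ⌊φ(φ+3)/6⌋, where κ₂(i) = 1 if i is odd and κ₂(i) = 0 otherwise, and where for odd i with ⌊i/2⌋ − κ₂(i) < 0 no pair (i, j) is counted. (The minimal objective basis 𝒫̃^φ_{r₂} of equation (27) for rotationally symmetric rules has cardinality n_r(φ).) -/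
/-- The index pairs `(i, j)` described without integer division: `i - 2 * j` is a natural number
different from `1`, and `i + j ≤ n`. -/
def rotationalIndices (n : ℕ) : Set (ℕ × ℕ) :=
  {p | p.1 + p.2 ≤ n ∧ 2 * p.2 ≤ p.1 ∧ p.1 ≠ 2 * p.2 + 1}

theorem rotationalIndices_finite (n : ℕ) : (rotationalIndices n).Finite := by
  refine ((Set.finite_Iic n).prod (Set.finite_Iic n)).subset ?_
  rintro ⟨i, j⟩ ⟨h, -, -⟩
  simp only [Set.mem_prod, Set.mem_Iic] at h ⊢
  omega

theorem rotationalIndices_add_three (n : ℕ) :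
    rotationalIndices (n + 3) =
      (fun p : ℕ × ℕ => (p.1 + 2, p.2 + 1)) '' rotationalIndices n ∪
        (fun i : ℕ => (i, 0)) '' ((Finset.range (n + 4)).erase 1 : Finset ℕ) := by
  ext ⟨i, j⟩
  simp only [rotationalIndices, Set.mem_union, Set.mem_image, Set.mem_ofPred_eq, Prod.exists,
    Prod.mk.injEq, Finset.mem_coe, Finset.mem_erase, Finset.mem_range]
  constructor
  · rintro ⟨h₁, h₂, h₃⟩
    rcases j with _ | j
    · exact Or.inr ⟨i, ⟨by omega, by omega⟩, rfl, rfl⟩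
    · exact Or.inl ⟨i - 2, j, ⟨by omega, by omega, by omega⟩, by omega, rfl⟩
  · rintro (⟨a, b, ⟨h₁, h₂, h₃⟩, rfl, rfl⟩ | ⟨a, ⟨h₁, h₂⟩, rfl, rfl⟩) <;> omega

theorem ncard_rotationalIndices_add_three (n : ℕ) :
    (rotationalIndices (n + 3)).ncard = (rotationalIndices n).ncard + (n + 3) := by
  have hdisj : Disjoint ((fun p : ℕ × ℕ => (p.1 + 2, p.2 + 1)) '' rotationalIndices n)
      ((fun i : ℕ => (i, 0)) '' ((Finset.range (n + 4)).erase 1 : Finset ℕ)) := by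
    rw [Set.disjoint_left]
    rintro _ ⟨p, -, rfl⟩ ⟨i, -, h⟩
    simp at h
  rw [rotationalIndices_add_three, Set.ncard_union_eq hdisj
    ((rotationalIndices_finite n).image _) ((Finset.finite_toSet _).image _),
    Set.ncard_image_of_injective, Set.ncard_image_of_injective, Set.ncard_coe_finset,
    Finset.card_erase_of_mem (by simp), Finset.card_range]
  · rfl
  · intro a b h
    simpa using h
  · rintro ⟨a, b⟩ ⟨c, d⟩ h
    simpa using h

theorem ncard_rotationalIndices : ∀ n : ℕ,
    (rotationalIndices n).ncard = 1 + n * (n + 3) / 6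
  | 0 => by
    have h : rotationalIndices 0 = {(0, 0)} := by
      ext ⟨i, j⟩
      simp only [rotationalIndices, Set.mem_ofPred_eq, Set.mem_singleton_iff, Prod.mk.injEq]
      omega
    rw [h, Set.ncard_singleton]
  | 1 => by
    have h : rotationalIndices 1 = {(0, 0)} := by
      ext ⟨i, j⟩
      simp only [rotationalIndices, Set.mem_ofPred_eq, Set.mem_singleton_iff, Prod.mk.injEq]
      omega
    rw [h, Set.ncard_singleton]
  | 2 => by
    have h : rotationalIndices 2 = {(0, 0), (2, 0)} := by
      ext ⟨i, j⟩
      simp only [rotationalIndices, Set.mem_ofPred_eq, Set.mem_insert_iff,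
        Set.mem_singleton_iff, Prod.mk.injEq]
      omega
    rw [h, Set.ncard_pair (by simp)]
  | n + 3 => by
    rw [ncard_rotationalIndices_add_three, ncard_rotationalIndices n,
      show (n + 3) * (n + 3 + 3) = n * (n + 3) + 6 * (n + 3) by ring,
      Nat.add_mul_div_left _ _ (by norm_num), add_assoc]

/-- The minimal objective basis `𝒫̃^φ_{r₂}` (equation (27)) for rotationally
symmetric rules has cardinality `n_r(φ)`: the number of pairs `(i, j)` of
naturals with `i ≤ φ` and `j ≤ min(φ − i, ⌊i/2⌋ − κ₂(i))`, the bound on `j`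
interpreted in `ℤ` (so odd `i = 1` contributes no pairs), equals
`1 + ⌊φ(φ+3)/6⌋`.  Here `κ₂(i) = 1` if `i` is odd and `0` otherwise. -/
theorem stmt_14 (φ : ℕ) :
    {p : ℕ × ℕ | p.1 ≤ φ ∧
      (p.2 : ℤ) ≤ min ((φ : ℤ) - (p.1 : ℤ))
        (((p.1 / 2 : ℕ) : ℤ) - (if p.1 % 2 = 1 then 1 else 0))}.ncard =
      1 + φ * (φ + 3) / 6 := by
  rw [← ncard_rotationalIndices]
  congr 1
  ext ⟨i, j⟩
  simp only [rotationalIndices, Set.mem_ofPred_eq, le_min_iff]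
  split_ifs <;> omega
end

section
/- Let p be a polynomial in three variables over ℝ that is invariant under the cyclic permutation of the variables (X₁, X₂, X₃) ↦ (X₂, X₃, X₁). Then there exist symmetric polynomials q and r in three variables over ℝ such that p = q + Δ·r, where Δ = (X₁ − X₂)(X₁ − X₃)(X₂ − X₃) is the alternating (Vandermonde) polynomial. -/
namespace MvPolynomial

section General

variable {σ R : Type*} [CommRing R] [DecidableEq σ]

/-- A polynomial is congruent, modulo `X i - X j`, to the result of substituting `X i` for `X j`. -/
lemma X_sub_X_dvd_sub_aeval_update (i j : σ) (p : MvPolynomial σ R) :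
    (X i - X j : MvPolynomial σ R) ∣ p - aeval (Function.update X j (X i)) p := by
  induction p using MvPolynomial.induction_on with
  | C a => simp [algebraMap_eq]
  | add p q hp hq => simpa only [map_add, add_sub_add_comm] using dvd_add hp hq
  | mul_X p k hp =>
    have hk : (X i - X j : MvPolynomial σ R) ∣
        X k - Function.update (X : σ → MvPolynomial σ R) j (X i) k := by
      by_cases h : k = j
      · subst h
        rw [Function.update_self, dvd_sub_comm]
      · simp [h]
    rw [map_mul, aeval_X]
    exact dvd_mul_sub_mul hp hk

lemma X_sub_X_dvd_of_aeval_update_eq_zero {i j : σ} {p : MvPolynomial σ R}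
    (hp : aeval (Function.update X j (X i)) p = (0 : MvPolynomial σ R)) :
    (X i - X j : MvPolynomial σ R) ∣ p := by
  simpa only [hp, sub_zero] using X_sub_X_dvd_sub_aeval_update i j p

/-- A polynomial that changes sign when two variables are swapped vanishes
when these variables are identified. -/
lemma aeval_update_eq_zero_of_rename_swap_eq_neg [IsDomain R] [CharZero R] {i j : σ}
    {p : MvPolynomial σ R} (hp : rename (Equiv.swap i j) p = -p) :
    aeval (Function.update X j (X i)) p = (0 : MvPolynomial σ R) := by
  have h := congrArg (aeval (Function.update (X : σ → MvPolynomial σ R) j (X i))) hp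
  have hcomp : Function.update (X : σ → MvPolynomial σ R) j (X i) ∘ Equiv.swap i j =
      Function.update X j (X i) := by
    funext k
    by_cases hi : k = i
    · subst hi
      by_cases hj : k = j <;> simp [hj]
    · by_cases hj : k = j
      · subst hj
        simp [Function.update_apply]
      · simp [Equiv.swap_apply_of_ne_of_ne hi hj]
  rw [aeval_rename, hcomp, map_neg] at h
  exact self_eq_neg.mp h

end General

section ThreeVariables

variable {R : Type*} [CommRing R]

/-- A polynomial in three variables that changes sign under every transposition is divisible by
the alternating polynomial. -/
lemma alternating_dvd_of_rename_swap_eq_neg [IsDomain R] [CharZero R] {p : MvPolynomial (Fin 3) R}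
    (h01 : rename (Equiv.swap 0 1) p = -p) (h02 : rename (Equiv.swap 0 2) p = -p)
    (h12 : rename (Equiv.swap 1 2) p = -p) :
    ((X 0 - X 1) * (X 0 - X 2) * (X 1 - X 2) : MvPolynomial (Fin 3) R) ∣ p := by
  have hne : (X 0 - X 1 : MvPolynomial (Fin 3) R) ≠ 0 :=
    sub_ne_zero.mpr fun h => absurd (X_injective h) (by decide)
  obtain ⟨a, rfl⟩ := X_sub_X_dvd_of_aeval_update_eq_zero
    (aeval_update_eq_zero_of_rename_swap_eq_neg h01)
  have ha := aeval_update_eq_zero_of_rename_swap_eq_neg h02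
  simp only [map_mul, map_sub, aeval_X, Function.update_apply] at ha
  obtain ⟨b, rfl⟩ := X_sub_X_dvd_of_aeval_update_eq_zero
    ((mul_eq_zero.mp ha).resolve_left (by simpa using hne))
  have hb := aeval_update_eq_zero_of_rename_swap_eq_neg h12
  simp only [map_mul, map_sub, aeval_X, Function.update_apply, ← mul_assoc] at hb
  obtain ⟨c, rfl⟩ := X_sub_X_dvd_of_aeval_update_eq_zero
    ((mul_eq_zero.mp hb).resolve_left (by simpa using hne))
  exact ⟨c, by ring⟩

/-- Symmetry in three variables can be tested on a transposition and a 3-cycle. -/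
lemma isSymmetric_of_rename_swap_of_rename_finRotate {p : MvPolynomial (Fin 3) R}
    (hswap : rename (Equiv.swap 0 1) p = p) (hrot : rename (finRotate 3) p = p) :
    p.IsSymmetric := by
  have key : ∀ e : Equiv.Perm (Fin 3),
      e = 1 ∨ e = finRotate 3 ∨ e = finRotate 3 * finRotate 3 ∨ e = Equiv.swap 0 1 ∨
      e = Equiv.swap 0 1 * finRotate 3 ∨ e = Equiv.swap 0 1 * (finRotate 3 * finRotate 3) := by
    decide
  intro e
  rcases key e with rfl | rfl | rfl | rfl | rfl | rfl <;>
    simp only [Equiv.Perm.coe_mul, Equiv.Perm.coe_one, ← rename_rename, rename_id_apply, hswap,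
      hrot]

end ThreeVariables

end MvPolynomial

open MvPolynomial in
/-- A polynomial `p ∈ ℝ[X₀, X₁, X₂]` invariant under the cyclic permutation
of the variables decomposes as `p = q + Δ · r` with `q`, `r` symmetric, where
`Δ = (X₀ − X₁)(X₀ − X₂)(X₁ − X₂)` is the alternating polynomial. -/
theorem stmt_16 (p : MvPolynomial (Fin 3) ℝ)
    (hp : MvPolynomial.rename (finRotate 3) p = p) :
    ∃ q r : MvPolynomial (Fin 3) ℝ, q.IsSymmetric ∧ r.IsSymmetric ∧
      p = q + (MvPolynomial.X 0 - MvPolynomial.X 1) *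
              (MvPolynomial.X 0 - MvPolynomial.X 2) *
              (MvPolynomial.X 1 - MvPolynomial.X 2) * r := by
  set t : MvPolynomial (Fin 3) ℝ := rename (Equiv.swap 0 1) p with ht
  have htt : rename (Equiv.swap 0 1) t = p := by
    rw [ht, rename_rename, ← Equiv.Perm.coe_mul, Equiv.swap_mul_self, Equiv.Perm.coe_one,
      rename_id_apply]
  have hrt : rename (finRotate 3) t = t := by
    have h : finRotate 3 * Equiv.swap 0 1 = Equiv.swap 0 1 * (finRotate 3 * finRotate 3) := by
      decide
    rw [ht, rename_rename, ← Equiv.Perm.coe_mul, h]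
    simp only [Equiv.Perm.coe_mul, ← rename_rename, hp]
  have h01 : rename (Equiv.swap 0 1) (p - t) = -(p - t) := by
    rw [map_sub, htt, ← ht, neg_sub]
  have hrot : rename (finRotate 3) (p - t) = p - t := by rw [map_sub, hp, hrt]
  have h02 : rename (Equiv.swap 0 2) (p - t) = -(p - t) := by
    have h : Equiv.swap (0 : Fin 3) 2 = Equiv.swap 0 1 * finRotate 3 ∨
        Equiv.swap (0 : Fin 3) 2 = Equiv.swap 0 1 * (finRotate 3 * finRotate 3) := by decide
    rcases h with h | h <;> rw [h] <;>
      simp only [Equiv.Perm.coe_mul, ← rename_rename, hrot, h01]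
  have h12 : rename (Equiv.swap 1 2) (p - t) = -(p - t) := by
    have h : Equiv.swap (1 : Fin 3) 2 = Equiv.swap 0 1 * finRotate 3 ∨
        Equiv.swap (1 : Fin 3) 2 = Equiv.swap 0 1 * (finRotate 3 * finRotate 3) := by decide
    rcases h with h | h <;> rw [h] <;>
      simp only [Equiv.Perm.coe_mul, ← rename_rename, hrot, h01]
  obtain ⟨s, hs⟩ := alternating_dvd_of_rename_swap_eq_neg h01 h02 h12
  have hΔ : ((X 0 - X 1) * (X 0 - X 2) * (X 1 - X 2) : MvPolynomial (Fin 3) ℝ) ≠ 0 := by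
    refine mul_ne_zero (mul_ne_zero ?_ ?_) ?_ <;>
      exact sub_ne_zero.mpr fun h => absurd (X_injective h) (by decide)
  have hf0 : finRotate 3 0 = 1 := by decide
  have hf1 : finRotate 3 1 = 2 := by decide
  have hf2 : finRotate 3 2 = 0 := by decide
  have hs2 : Equiv.swap (0 : Fin 3) 1 2 = 2 := by decide
  have hssym : s.IsSymmetric := by
    refine isSymmetric_of_rename_swap_of_rename_finRotate ?_ ?_ <;>
      apply mul_left_cancel₀ hΔ
    · rw [hs] at h01
      simp only [map_mul, map_sub, rename_X, Equiv.swap_apply_left, Equiv.swap_apply_right,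
        hs2] at h01
      linear_combination -h01
    · rw [hs] at hrot
      simp only [map_mul, map_sub, rename_X, hf0, hf1, hf2] at hrot
      linear_combination hrot
  have hqsym : (p + t).IsSymmetric := by
    refine isSymmetric_of_rename_swap_of_rename_finRotate ?_ ?_
    · rw [map_add, htt, ← ht, add_comm]
    · rw [map_add, hp, hrt]
  refine ⟨(1 / 2 : ℝ) • (p + t), (1 / 2 : ℝ) • s, hqsym.smul _, hssym.smul _, ?_⟩
  rw [mul_smul_comm, ← hs, ← smul_add, add_add_sub_cancel, ← two_smul ℝ p, smul_smul]
  norm_num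
end
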